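/- Let s > 1/2. There exists C = C(s) such that for any M ≥ 1 and all v₁, v₂, v₃ ∈ H^s(ℝ), ‖T^w_{|Φ|>M}(v₁,v₂,v₃)‖_{H^s(ℝ)} ≤ C M^{-1/2} ∏_{j=1}^3 ‖v_j‖_{H^s(ℝ)}, where T^w_{|Φ|>M} is defined on the Fourier side by integrating (|ξ₂|/⟨Φ(ξ̄)⟩) v̂₁(ξ₁) conj(v̂₂(ξ₂)) v̂₃(ξ₃) over the hyperplane ξ = ξ₁-ξ₂+ξ₃ restricted to |Φ(ξ̄)| > M. -/

import Mathlib

open MeasureTheory FourierTransform Complex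

/-- The Japanese bracket `⟨x⟩ = (1+x²)^{1/2}`. -/
noncomputable def jb (x : ℝ) : ℝ := (1 + x ^ 2) ^ ((1 : ℝ) / 2)

/-- The Sobolev `H^s(ℝ)` norm, defined on the Fourier side. -/
noncomputable def sobolevNorm (s : ℝ) (f : ℝ → ℂ) : ℝ :=
  (∫ ξ : ℝ, jb ξ ^ (2 * s) * ‖𝓕 f ξ‖ ^ 2) ^ ((1 : ℝ) / 2)

/-- Membership in the Sobolev space `H^s(ℝ)`. -/
def memHs (s : ℝ) (f : ℝ → ℂ) : Prop :=
  Integrable (fun ξ : ℝ => jb ξ ^ (2 * s) * ‖𝓕 f ξ‖ ^ 2)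

/-- The modulation function `Φ(ξ̄) = ξ² - ξ₁² + ξ₂² - ξ₃²`. -/
def modPhi (ξ ξ₁ ξ₂ ξ₃ : ℝ) : ℝ := ξ ^ 2 - ξ₁ ^ 2 + ξ₂ ^ 2 - ξ₃ ^ 2

/-- The trilinear operator `T^w_{|Φ|>M}`, defined on the Fourier side by
integrating `(|ξ₂|/⟨Φ(ξ̄)⟩) v̂₁(ξ₁) conj(v̂₂(ξ₂)) v̂₃(ξ₃)` over the hyperplane
`ξ = ξ₁ - ξ₂ + ξ₃` restricted to `|Φ(ξ̄)| > M`, with `ξ₃ = ξ - ξ₁ + ξ₂`. -/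
noncomputable def TwAbove (M : ℝ) (v₁ v₂ v₃ : ℝ → ℂ) : ℝ → ℂ :=
  𝓕⁻ fun ξ : ℝ => ∫ ξ₁ : ℝ, ∫ ξ₂ : ℝ,
    (if M < |modPhi ξ ξ₁ ξ₂ (ξ - ξ₁ + ξ₂)| then
        ((|ξ₂| / jb (modPhi ξ ξ₁ ξ₂ (ξ - ξ₁ + ξ₂)) : ℝ) : ℂ)
      else 0) *
      𝓕 v₁ ξ₁ * (starRingEnd ℂ) (𝓕 v₂ ξ₂) * 𝓕 v₃ (ξ - ξ₁ + ξ₂)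

lemma jb_eq_sqrt (x : ℝ) : jb x = √(1 + x ^ 2) := by
  rw [jb, Real.sqrt_eq_rpow]

lemma continuous_jb : Continuous jb := by
  simp only [funext jb_eq_sqrt]
  fun_prop

lemma one_le_jb (x : ℝ) : 1 ≤ jb x := by
  rw [jb_eq_sqrt, Real.one_le_sqrt]
  nlinarith [sq_nonneg x]

lemma jb_pos (x : ℝ) : 0 < jb x := one_pos.trans_le (one_le_jb x)

lemma abs_le_jb (x : ℝ) : |x| ≤ jb x := by
  rw [jb_eq_sqrt]
  exact Real.abs_le_sqrt (by linarith)

lemma jb_sq (x : ℝ) : jb x ^ 2 = 1 + x ^ 2 := by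
  rw [jb_eq_sqrt, Real.sq_sqrt (by positivity)]

lemma jb_mono {x y : ℝ} (h : |x| ≤ |y|) : jb x ≤ jb y := by
  rw [jb_eq_sqrt, jb_eq_sqrt]
  exact Real.sqrt_le_sqrt (by linarith [sq_le_sq.2 h])

lemma jb_add_le (x y : ℝ) : jb (x + y) ≤ jb x + |y| := by
  refine (sq_le_sq₀ (jb_pos _).le (by linarith [jb_pos x, abs_nonneg y])).1 ?_
  have h : x * y ≤ jb x * |y| := (le_abs_self _).trans
    (by rw [abs_mul]; exact mul_le_mul_of_nonneg_right (abs_le_jb x) (abs_nonneg y))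
  nlinarith [jb_sq x, jb_sq (x + y), sq_abs y]

lemma jb_le_two_mul {x y : ℝ} (h : |x| ≤ 2 * |y|) : jb x ≤ 2 * jb y := by
  refine (sq_le_sq₀ (jb_pos _).le (by linarith [jb_pos y])).1 ?_
  have : x ^ 2 ≤ 4 * y ^ 2 := by nlinarith [sq_abs x, sq_abs y, abs_nonneg x, abs_nonneg y]
  nlinarith [jb_sq x, jb_sq y]

/-- The integrable profile `|x|^{-θ} ⟨x⟩^{-b}`. -/
noncomputable def singWeight (θ b x : ℝ) : ℝ := |x| ^ (-θ) * jb x ^ (-b)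

lemma singWeight_nonneg (θ b x : ℝ) : 0 ≤ singWeight θ b x := by
  have := jb_pos x
  unfold singWeight
  positivity

lemma inv_le_rpow_neg_mul {θ x y J : ℝ} (hθ0 : 0 ≤ θ) (hθ1 : θ ≤ 1) (hx : 0 < |x|) (hy : 0 < |y|)
    (hJ : 1 ≤ J) (h : |x| * |y| ≤ J) : J⁻¹ ≤ |x| ^ (-θ) * |y| ^ (-θ) := by
  rw [← Real.mul_rpow hx.le hy.le, ← Real.rpow_neg_one]
  calc J ^ (-1 : ℝ) ≤ J ^ (-θ) := Real.rpow_le_rpow_of_exponent_le hJ (by linarith)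
    _ ≤ _ := Real.rpow_le_rpow_of_nonpos (by positivity) h (by linarith)

lemma rpow_jb_anti {b x y : ℝ} (hb : 0 ≤ b) (h : |x| ≤ |y|) : jb y ^ (-b) ≤ jb x ^ (-b) :=
  Real.rpow_le_rpow_of_nonpos (jb_pos x) (jb_mono h) (by linarith)

/-- `⟨z⟩^{-2b} / J` is dominated by the product of profiles at `x`, `y`. -/
lemma rpow_div_le_singWeight {θ b x y z J : ℝ} (hθ0 : 0 ≤ θ) (hθ1 : θ ≤ 1) (hb : 0 ≤ b)
    (hx : 0 < |x|) (hy : 0 < |y|) (hJ : 1 ≤ J) (h : |x| * |y| ≤ J)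
    (hxz : |x| ≤ |z|) (hyz : |y| ≤ |z|) :
    (jb z ^ (-b)) ^ 2 * J⁻¹ ≤ singWeight θ b x * singWeight θ b y := by
  have hz := jb_pos z
  have hx' := jb_pos x
  have hy' := jb_pos y
  have h1 := rpow_jb_anti hb hxz
  have h2 := rpow_jb_anti hb hyz
  have h3 := inv_le_rpow_neg_mul hθ0 hθ1 hx hy hJ h
  calc (jb z ^ (-b)) ^ 2 * J⁻¹
      ≤ (jb x ^ (-b) * jb y ^ (-b)) * (|x| ^ (-θ) * |y| ^ (-θ)) := by
        rw [sq]; gcongr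
    _ = _ := by unfold singWeight; ring

lemma rpow_add_le_two {a x y : ℝ} (ha : 0 ≤ a) (hx : 0 ≤ x) (hy : 0 ≤ y) :
    (x + y) ^ a ≤ 2 ^ a * (x ^ a + y ^ a) := by
  have key : ∀ u v : ℝ, 0 ≤ u → 0 ≤ v → u ≤ v → (u + v) ^ a ≤ 2 ^ a * (u ^ a + v ^ a) := by
    intro u v hu hv h
    calc (u + v) ^ a ≤ (2 * v) ^ a := Real.rpow_le_rpow (by linarith) (by linarith) ha
      _ = 2 ^ a * v ^ a := Real.mul_rpow (by norm_num) hv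
      _ ≤ _ := by
        gcongr
        linarith [Real.rpow_nonneg hu a]
  rcases le_total x y with h | h
  · exact key x y hx hy h
  · rw [add_comm x, add_comm (x ^ a)]
    exact key y x hy hx h

lemma rpow_neg_le_of_le_two_mul {a x y : ℝ} (ha : 0 ≤ a) (hx : 0 < x) (hy : 0 < y)
    (h : x ≤ 2 * y) : y ^ (-a) ≤ 2 ^ a * x ^ (-a) := by
  calc y ^ (-a) = 2 ^ a * (2 * y) ^ (-a) := by
        rw [Real.mul_rpow (by norm_num) hy.le, ← mul_assoc, ← Real.rpow_add (by norm_num)]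
        simp
    _ ≤ _ := by
        gcongr ?_ * ?_
        exact Real.rpow_le_rpow_of_nonpos hx h (by linarith)

lemma multiplier_sq_le_of_near {θ b x₁ x₂ x₃ J : ℝ} (hθ0 : 0 ≤ θ) (hθ1 : θ ≤ 1) (hb : 0 ≤ b)
    (hh : 0 < |x₁ - x₂|) (hk : 0 < |x₃ - x₂|) (hJ : 1 ≤ J)
    (hJΦ : 2 * (|x₁ - x₂| * |x₃ - x₂|) ≤ J) (hnear : |x₁ - x₂| < |x₂| / 2) :
    jb (x₁ - x₂ + x₃) ^ (1 + b) * x₂ ^ 2 * J⁻¹ *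
        (jb x₁ ^ (-(1 + b)) * jb x₂ ^ (-(1 + b)) * jb x₃ ^ (-(1 + b))) ≤
      8 ^ (1 + b) * (jb x₂ ^ (-(1 + b)) * jb x₃ ^ (-(1 + b)) +
        singWeight θ b (x₁ - x₂) * singWeight θ b (x₃ - x₂) +
        singWeight θ b (x₁ - x₂) * singWeight θ b x₂) := by
  have ha : (0 : ℝ) ≤ 1 + b := by linarith
  have ht := jb_pos x₂
  have ht3 := jb_pos x₃
  have ht1 := jb_pos x₁
  have htξ := jb_pos (x₁ - x₂ + x₃)
  have hx2 : 0 < |x₂| := by linarith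
  have hxt : x₂ ^ 2 ≤ jb x₂ ^ 2 := by linarith [jb_sq x₂]
  have hJ0 : 0 < J := by linarith
  have hcpos : (0 : ℝ) < 2 ^ (1 + b) := by positivity
  have h8 : (8 : ℝ) ^ (1 + b) = 2 ^ (1 + b) * 2 ^ (1 + b) * 2 ^ (1 + b) := by
    rw [← Real.mul_rpow (by norm_num) (by norm_num), ← Real.mul_rpow (by norm_num) (by norm_num)]
    norm_num
  have h21 : (1 : ℝ) ≤ 2 ^ (1 + b) := Real.one_le_rpow (by norm_num) ha
  have hw1 := singWeight_nonneg θ b (x₁ - x₂)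
  have hw2 := singWeight_nonneg θ b x₂
  have hw3 := singWeight_nonneg θ b (x₃ - x₂)
  have htri1 : |x₂| ≤ |x₁| + |x₁ - x₂| := by
    have := abs_sub x₁ (x₁ - x₂); rwa [sub_sub_cancel] at this
  have hp1 : jb x₁ ^ (-(1 + b)) ≤ 2 ^ (1 + b) * jb x₂ ^ (-(1 + b)) :=
    rpow_neg_le_of_le_two_mul ha ht ht1 (jb_le_two_mul (by linarith))
  have hpb : jb x₂ ^ (-b) = jb x₂ * jb x₂ ^ (-(1 + b)) := by
    rw [show -b = 1 + -(1 + b) by ring, Real.rpow_add ht, Real.rpow_one]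
  have hcancel : jb x₂ ^ (1 + b) * jb x₂ ^ (-(1 + b)) = 1 := by
    rw [← Real.rpow_add ht]; simp
  have hcancel3 : jb x₃ ^ (1 + b) * jb x₃ ^ (-(1 + b)) = 1 := by
    rw [← Real.rpow_add ht3]; simp
  have hsplit : jb x₂ ^ (1 + b) = jb x₂ * jb x₂ ^ b := by
    rw [Real.rpow_add ht, Real.rpow_one]
  set A := jb (x₁ - x₂ + x₃) ^ (1 + b) with hA
  set p1 := jb x₁ ^ (-(1 + b)) with hp1d
  set p2 := jb x₂ ^ (-(1 + b)) with hp2d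
  set p3 := jb x₃ ^ (-(1 + b)) with hp3d
  have p1pos : 0 < p1 := by positivity
  have p2pos : 0 < p2 := by positivity
  have p3pos : 0 < p3 := by positivity
  have hA0 : 0 < A := by positivity
  set c : ℝ := 2 ^ (1 + b) with hc
  rcases lt_or_ge |x₃ - x₂| (|x₂| / 2) with hk2 | hk2
  · have htri3 : |x₂| ≤ |x₃| + |x₃ - x₂| := by
      have := abs_sub x₃ (x₃ - x₂); rwa [sub_sub_cancel] at this
    have hp3 : p3 ≤ c * p2 :=
      rpow_neg_le_of_le_two_mul ha ht ht3 (jb_le_two_mul (by linarith))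
    have hA1 : A ≤ c * jb x₂ ^ (1 + b) := by
      rw [hA, hc, ← Real.mul_rpow (by norm_num) ht.le]
      refine Real.rpow_le_rpow htξ.le (jb_le_two_mul ?_) ha
      have h1 := abs_add_le (x₁ - x₂ + (x₃ - x₂)) x₂
      have h2 := abs_add_le (x₁ - x₂) (x₃ - x₂)
      have h3 : x₁ - x₂ + (x₃ - x₂) + x₂ = x₁ - x₂ + x₃ := by ring
      rw [h3] at h1
      linarith
    have key := rpow_div_le_singWeight (z := x₂) hθ0 hθ1 hb hh hk hJ
      (by nlinarith [mul_pos hh hk]) (by linarith) (by linarith)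
    calc A * x₂ ^ 2 * J⁻¹ * (p1 * p2 * p3)
        ≤ (c * jb x₂ ^ (1 + b)) * jb x₂ ^ 2 * J⁻¹ * (c * p2 * p2 * (c * p2)) := by gcongr
      _ = c * c * c * ((jb x₂ * p2) ^ 2 * J⁻¹) * (jb x₂ ^ (1 + b) * p2) := by ring
      _ = c * c * c * ((jb x₂ ^ (-b)) ^ 2 * J⁻¹) := by rw [hcancel, ← hpb, mul_one]
      _ ≤ c * c * c * (singWeight θ b (x₁ - x₂) * singWeight θ b (x₃ - x₂)) := by gcongr
      _ ≤ _ := by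
        rw [h8]
        gcongr
        have := mul_nonneg hw1 hw2
        have := mul_pos p2pos p3pos
        linarith
  · have hA1 : A ≤ c * (jb x₃ ^ (1 + b) + |x₁ - x₂| ^ (1 + b)) := by
      refine le_trans (Real.rpow_le_rpow htξ.le ?_ ha) (rpow_add_le_two ha ht3.le hh.le)
      rw [add_comm (x₁ - x₂)]
      exact jb_add_le _ _
    have hJ2 : |x₁ - x₂| * |x₂| ≤ J := by nlinarith
    have key := rpow_div_le_singWeight (z := x₂) hθ0 hθ1 hb hh hx2 hJ hJ2 (by linarith) le_rfl
    have hfar : |x₁ - x₂| ^ (1 + b) * x₂ ^ 2 * J⁻¹ ≤ jb x₂ ^ (1 + b) := by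
      rw [hsplit, Real.rpow_add hh, Real.rpow_one]
      calc |x₁ - x₂| * |x₁ - x₂| ^ b * x₂ ^ 2 * J⁻¹
          = |x₂| * |x₁ - x₂| ^ b * ((|x₁ - x₂| * |x₂|) * J⁻¹) := by rw [← sq_abs x₂]; ring
        _ ≤ jb x₂ * jb x₂ ^ b * 1 := by
          gcongr
          · exact abs_le_jb x₂
          · linarith [abs_le_jb x₂]
          · rw [← div_eq_mul_inv]; exact (div_le_one hJ0).2 hJ2
        _ = _ := mul_one _
    calc A * x₂ ^ 2 * J⁻¹ * (p1 * p2 * p3)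
        ≤ (c * (jb x₃ ^ (1 + b) + |x₁ - x₂| ^ (1 + b))) * x₂ ^ 2 * J⁻¹ * (c * p2 * p2 * p3) := by
          gcongr
      _ = c * c * ((x₂ ^ 2 * p2 * p2 * J⁻¹) * (jb x₃ ^ (1 + b) * p3) +
            (|x₁ - x₂| ^ (1 + b) * x₂ ^ 2 * J⁻¹) * p2 * p2 * p3) := by ring
      _ ≤ c * c * ((jb x₂ ^ 2 * p2 * p2 * J⁻¹) * (jb x₃ ^ (1 + b) * p3) +
            jb x₂ ^ (1 + b) * p2 * p2 * p3) := by gcongr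
      _ = c * c * (1 * ((jb x₂ ^ (-b)) ^ 2 * J⁻¹ + p2 * p3)) := by
          rw [hcancel3, hcancel, hpb]; ring
      _ ≤ c * c * (c * (singWeight θ b (x₁ - x₂) * singWeight θ b x₂ + p2 * p3)) := by gcongr
      _ ≤ _ := by
        rw [h8, ← mul_assoc (c * c)]
        have := mul_nonneg hw1 hw3
        exact mul_le_mul_of_nonneg_left (by linarith) (by positivity)

/-- The six-term majorant of the squared symbol of the trilinear operator. -/
def majorant {R : Type*} [Semiring R] (p q : ℝ → R) (x₁ x₂ x₃ : ℝ) : R :=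
  p x₁ * p x₂ + p x₂ * p x₃ + p x₁ * p x₃ +
    q (x₁ - x₂) * q (x₃ - x₂) + q (x₁ - x₂) * q x₂ + q (x₃ - x₂) * q x₂

lemma multiplier_sq_le {θ b x₁ x₂ x₃ J : ℝ} (hθ0 : 0 ≤ θ) (hθ1 : θ ≤ 1) (hb : 0 ≤ b)
    (hh : 0 < |x₁ - x₂|) (hk : 0 < |x₃ - x₂|) (hJ : 1 ≤ J)
    (hJΦ : 2 * (|x₁ - x₂| * |x₃ - x₂|) ≤ J) :
    jb (x₁ - x₂ + x₃) ^ (1 + b) * x₂ ^ 2 * J⁻¹ *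
        (jb x₁ ^ (-(1 + b)) * jb x₂ ^ (-(1 + b)) * jb x₃ ^ (-(1 + b))) ≤
      8 ^ (1 + b) * majorant (fun x => jb x ^ (-(1 + b))) (singWeight θ b) x₁ x₂ x₃ := by
  have ha : (0 : ℝ) ≤ 1 + b := by linarith
  have ht := jb_pos x₂
  have ht3 := jb_pos x₃
  have ht1 := jb_pos x₁
  have hw1 := singWeight_nonneg θ b (x₁ - x₂)
  have hw2 := singWeight_nonneg θ b x₂
  have hw3 := singWeight_nonneg θ b (x₃ - x₂)
  have hp1 : 0 < jb x₁ ^ (-(1 + b)) := by positivity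
  have hp2 : 0 < jb x₂ ^ (-(1 + b)) := by positivity
  have hp3 : 0 < jb x₃ ^ (-(1 + b)) := by positivity
  have h12 := mul_pos hp1 hp2
  have h23 := mul_pos hp2 hp3
  have h13 := mul_pos hp1 hp3
  have w12 := mul_nonneg hw1 hw2
  have w32 := mul_nonneg hw3 hw2
  have w13 := mul_nonneg hw1 hw3
  unfold majorant
  rcases lt_or_ge |x₁ - x₂| (|x₂| / 2) with h1 | h1
  · refine (multiplier_sq_le_of_near hθ0 hθ1 hb hh hk hJ hJΦ h1).trans ?_
    exact mul_le_mul_of_nonneg_left (by linarith) (by positivity)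
  rcases lt_or_ge |x₃ - x₂| (|x₂| / 2) with h3 | h3
  · have := multiplier_sq_le_of_near hθ0 hθ1 hb hk hh hJ (by linarith) h3
    rw [show x₃ - x₂ + x₁ = x₁ - x₂ + x₃ by ring] at this
    calc _ = _ := by ring
      _ ≤ _ := this
      _ ≤ _ := mul_le_mul_of_nonneg_left (by linarith) (by positivity)
  have hJ0 : 0 < J := by linarith
  have hle : x₂ ^ 2 * J⁻¹ ≤ 2 := by
    rw [← div_eq_mul_inv, div_le_iff₀ hJ0, ← sq_abs]
    nlinarith [abs_nonneg x₂]
  have hc1 : jb x₁ ^ (1 + b) * jb x₁ ^ (-(1 + b)) = 1 := by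
    rw [← Real.rpow_add ht1]; simp
  have hc2 : jb x₂ ^ (1 + b) * jb x₂ ^ (-(1 + b)) = 1 := by
    rw [← Real.rpow_add ht]; simp
  have hc3 : jb x₃ ^ (1 + b) * jb x₃ ^ (-(1 + b)) = 1 := by
    rw [← Real.rpow_add ht3]; simp
  have h8 : (8 : ℝ) ^ (1 + b) = 2 ^ (1 + b) * 2 ^ (1 + b) * 2 ^ (1 + b) := by
    rw [← Real.mul_rpow (by norm_num) (by norm_num), ← Real.mul_rpow (by norm_num) (by norm_num)]
    norm_num
  have h2 : (2 : ℝ) ≤ 2 ^ (1 + b) := by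
    simpa using Real.rpow_le_rpow_of_exponent_le (x := 2) (by norm_num) (by linarith : 1 ≤ 1 + b)
  have hA : jb (x₁ - x₂ + x₃) ^ (1 + b) ≤ 2 ^ (1 + b) * (2 ^ (1 + b) *
      (jb x₁ ^ (1 + b) + jb x₂ ^ (1 + b) + jb x₃ ^ (1 + b))) := by
    have e1 : jb (x₁ - x₂ + x₃) ≤ jb x₁ + jb x₂ + jb x₃ := by
      have e2 := jb_add_le (x₁ + -x₂) x₃
      have e3 := jb_add_le x₁ (-x₂)
      rw [abs_neg] at e3
      rw [← sub_eq_add_neg] at e2 e3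
      linarith [abs_le_jb x₂, abs_le_jb x₃]
    refine (Real.rpow_le_rpow (jb_pos _).le e1 ha).trans ?_
    refine (rpow_add_le_two ha (by positivity) ht3.le).trans ?_
    gcongr
    have e4 := rpow_add_le_two ha ht1.le ht.le
    have : jb x₃ ^ (1 + b) ≤ 2 ^ (1 + b) * jb x₃ ^ (1 + b) :=
      le_mul_of_one_le_left (by positivity) (by linarith)
    linarith
  set p1 := jb x₁ ^ (-(1 + b))
  set p2 := jb x₂ ^ (-(1 + b))
  set p3 := jb x₃ ^ (-(1 + b))
  set c : ℝ := 2 ^ (1 + b)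
  have hc : 0 < c := by linarith
  calc jb (x₁ - x₂ + x₃) ^ (1 + b) * x₂ ^ 2 * J⁻¹ * (p1 * p2 * p3)
      = jb (x₁ - x₂ + x₃) ^ (1 + b) * (x₂ ^ 2 * J⁻¹) * (p1 * p2 * p3) := by ring
    _ ≤ (c * (c * (jb x₁ ^ (1 + b) + jb x₂ ^ (1 + b) + jb x₃ ^ (1 + b)))) * c * (p1 * p2 * p3) := by
        gcongr
        linarith
    _ = c * c * c * ((jb x₁ ^ (1 + b) * p1) * p2 * p3 + (jb x₂ ^ (1 + b) * p2) * p1 * p3 +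
          (jb x₃ ^ (1 + b) * p3) * p1 * p2) := by ring
    _ = c * c * c * (p1 * p2 + p2 * p3 + p1 * p3) := by rw [hc1, hc2, hc3]; ring
    _ ≤ _ := by
        rw [h8]
        exact mul_le_mul_of_nonneg_left (by linarith) (by positivity)

lemma measurable_singWeight (θ b : ℝ) : Measurable (singWeight θ b) := by
  have := continuous_jb.measurable
  unfold singWeight
  fun_prop

lemma integrable_jb_rpow_neg {a : ℝ} (ha : 1 < a) : Integrable fun x => jb x ^ (-a) := by
  refine (integrable_rpow_neg_one_add_norm_sq (E := ℝ) (μ := volume) (r := a)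
    (by simpa using ha)).congr (.of_forall fun x => ?_)
  have : (0 : ℝ) ≤ 1 + x ^ 2 := by positivity
  simp only [jb, Real.norm_eq_abs, sq_abs]
  rw [← Real.rpow_mul this]
  congr 1
  ring

lemma integrable_singWeight {θ b : ℝ} (hθ : θ < 1) (hb : 0 ≤ b) (h : 1 < θ + b) :
    Integrable (singWeight θ b) := by
  have hpos : IntegrableOn (singWeight θ b) (Set.Ioi 0) := by
    rw [← Set.Ioc_union_Ioi_eq_Ioi zero_le_one]
    refine IntegrableOn.union ?_ ?_
    · have h1 : IntegrableOn (fun x : ℝ => x ^ (-θ)) (Set.Ioc 0 1) :=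
        (intervalIntegrable_iff_integrableOn_Ioc_of_le zero_le_one).1
          (intervalIntegral.intervalIntegrable_rpow' (by linarith))
      refine h1.mono' (measurable_singWeight θ b).aestronglyMeasurable ?_
      refine (ae_restrict_iff' measurableSet_Ioc).2 (.of_forall fun x hx => ?_)
      rw [Real.norm_of_nonneg (singWeight_nonneg θ b x), singWeight, abs_of_pos hx.1]
      exact mul_le_of_le_one_right (Real.rpow_nonneg hx.1.le _)
        (Real.rpow_le_one_of_one_le_of_nonpos (one_le_jb x) (by linarith))
    · have h1 := integrableOn_Ioi_rpow_of_lt (a := -θ + -b) (c := 1) (by linarith) one_pos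
      refine h1.mono' (measurable_singWeight θ b).aestronglyMeasurable ?_
      refine (ae_restrict_iff' measurableSet_Ioi).2 (.of_forall fun x hx => ?_)
      have hx0 : 0 < x := one_pos.trans hx
      rw [Real.norm_of_nonneg (singWeight_nonneg θ b x), singWeight, abs_of_pos hx0,
        Real.rpow_add hx0]
      gcongr ?_ * ?_
      exact Real.rpow_le_rpow_of_nonpos hx0 ((le_abs_self x).trans (abs_le_jb x)) (neg_nonpos.2 hb)
  have hneg : IntegrableOn (singWeight θ b) (Set.Iic 0) := by
    rw [← Measure.map_neg_eq_self (volume : Measure ℝ)]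
    have m : MeasurableEmbedding fun x : ℝ => -x := (Homeomorph.neg ℝ).measurableEmbedding
    rw [m.integrableOn_map_iff]
    have heven : singWeight θ b ∘ (fun x => -x) = singWeight θ b := by
      funext x
      simp [singWeight, jb]
    rw [heven]
    simpa using (integrableOn_Ici_iff_integrableOn_Ioi (by finiteness)).2 hpos
  rw [← integrableOn_univ, ← Set.Iic_union_Ioi (a := (0 : ℝ))]
  exact hneg.union hpos

open scoped ENNReal

lemma lintegral_lintegral_mul_eq {f g : ℝ → ℝ≥0∞} (hf : Measurable f) (hg : Measurable g) :
    ∫⁻ x, ∫⁻ y, f x * g y = (∫⁻ x, f x) * ∫⁻ y, g y := by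
  simp_rw [lintegral_const_mul _ hg]
  rw [lintegral_mul_const _ hf]

lemma lintegral_majorant {p q : ℝ → ℝ≥0∞} (hp : Measurable p) (hq : Measurable q) (ξ : ℝ) :
    ∫⁻ x, ∫⁻ y, majorant p q x y (ξ - x + y) =
      3 * ((∫⁻ x, p x) * ∫⁻ x, p x) + 3 * ((∫⁻ x, q x) * ∫⁻ x, q x) := by
  have e : ∀ x y : ℝ, ξ - x + y - y = ξ - x := fun x y => by ring
  unfold majorant
  simp only [e]
  have i1 := lintegral_lintegral_mul_eq hp hp
  have i2 : ∫⁻ x, ∫⁻ y, p y * p (ξ - x + y) = (∫⁻ x, p x) * ∫⁻ x, p x := by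
    rw [lintegral_lintegral_swap (by fun_prop)]
    simp_rw [sub_add_eq_add_sub, ← i1]
    refine lintegral_congr fun y => ?_
    exact lintegral_sub_left_eq_self (fun z => p y * p z) (ξ + y)
  have i3 : ∫⁻ x, ∫⁻ y, p x * p (ξ - x + y) = (∫⁻ x, p x) * ∫⁻ x, p x := by
    rw [← i1]
    refine lintegral_congr fun x => ?_
    exact lintegral_add_left_eq_self (fun z => p x * p z) (ξ - x)
  have j1 := lintegral_lintegral_mul_eq hq hq
  have j2 : ∫⁻ x, ∫⁻ y, q (x - y) * q (ξ - x) = (∫⁻ x, q x) * ∫⁻ x, q x := by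
    rw [← lintegral_lintegral_mul_eq hq hq,
      ← lintegral_sub_left_eq_self (fun z => ∫⁻ y, q z * q y) ξ]
    refine lintegral_congr fun x => ?_
    rw [lintegral_sub_left_eq_self (fun z => q z * q (ξ - x)) x]
    simp_rw [mul_comm]
  have j3 : ∫⁻ x, ∫⁻ y, q (x - y) * q y = (∫⁻ x, q x) * ∫⁻ x, q x := by
    rw [lintegral_lintegral_swap (by fun_prop), ← j1]
    refine lintegral_congr fun y => ?_
    rw [lintegral_sub_right_eq_self (fun z => q z * q y) y]
    simp_rw [mul_comm]
  have j4 : ∫⁻ x, ∫⁻ y, q (ξ - x) * q y = (∫⁻ x, q x) * ∫⁻ x, q x := by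
    rw [lintegral_sub_left_eq_self (fun z => ∫⁻ y, q z * q y) ξ, j1]
  have step : ∀ F G : ℝ → ℝ → ℝ≥0∞, Measurable (Function.uncurry F) →
      ∫⁻ x, ∫⁻ y, F x y + G x y = (∫⁻ x, ∫⁻ y, F x y) + ∫⁻ x, ∫⁻ y, G x y := by
    intro F G hF
    rw [← lintegral_add_left hF.lintegral_prod_right]
    exact lintegral_congr fun x => lintegral_add_left (hF.of_uncurry_left) _
  rw [step _ _ (by fun_prop), step _ _ (by fun_prop), step _ _ (by fun_prop),
    step _ _ (by fun_prop), step _ _ (by fun_prop), i1, i2, i3, j2, j3, j4]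
  ring

lemma continuous_fourier_of_integrable {f : ℝ → ℂ} (hf : Integrable f) : Continuous (𝓕 f) :=
  VectorFourier.fourierIntegral_continuous Real.continuous_fourierChar
    (by exact continuous_inner) hf

lemma fourier_eq_zero_of_not_integrable {f : ℝ → ℂ} (hf : ¬ Integrable f) : 𝓕 f = 0 := by
  funext w
  rw [Real.fourier_eq]
  exact integral_undef fun h => hf ((Real.fourierIntegral_convergent_iff w).1 h)

lemma measurable_fourier (f : ℝ → ℂ) : Measurable (𝓕 f) := by
  by_cases hf : Integrable f
  · exact (continuous_fourier_of_integrable hf).measurable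
  · rw [fourier_eq_zero_of_not_integrable hf]
    exact measurable_zero

/-- If `F` and its inverse Fourier transform are integrable, Fourier inversion holds almost
everywhere. -/
lemma fourier_fourierInv_ae_eq {F : ℝ → ℂ} (hF : Integrable F) (hFinv : Integrable (𝓕⁻ F)) :
    𝓕 (𝓕⁻ F) =ᵐ[volume] F := by
  refine ae_eq_of_integral_contDiff_smul_eq
    (continuous_fourier_of_integrable hFinv).locallyIntegrable hF.locallyIntegrable ?_
  intro g hg hgc
  let φ : SchwartzMap ℝ ℂ :=
    (hgc.comp_left (g := fun x : ℝ => (x : ℂ)) (by simp)).toSchwartzMap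
      (Complex.ofRealCLM.contDiff.comp hg)
  have hφ : ∀ x, φ x = (g x : ℂ) := fun x => rfl
  have hφF : (𝓕 (φ : ℝ → ℂ)) = (𝓕 φ : SchwartzMap ℝ ℂ) := (SchwartzMap.fourier_coe φ).symm
  have hφi : Integrable (𝓕 (φ : ℝ → ℂ)) := by
    rw [hφF]
    exact SchwartzMap.integrable _
  have hinv : 𝓕⁻ (𝓕 (φ : ℝ → ℂ)) = φ :=
    Continuous.fourierInv_fourier_eq φ.continuous φ.integrable hφi
  have flip1 : ∫ x, 𝓕 (φ : ℝ → ℂ) x • (𝓕⁻ F) x = ∫ x, φ x • 𝓕 (𝓕⁻ F) x := by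
    simpa using! VectorFourier.integral_fourierIntegral_smul_eq_flip (L := innerₗ ℝ)
      Real.continuous_fourierChar continuous_inner φ.integrable hFinv
  have flip2 : ∫ x, 𝓕⁻ (𝓕 (φ : ℝ → ℂ)) x • F x = ∫ x, 𝓕 (φ : ℝ → ℂ) x • (𝓕⁻ F) x := by
    have hsymm : (-innerₗ ℝ).flip = -innerₗ ℝ := by
      ext
      simp
    have h := VectorFourier.integral_fourierIntegral_smul_eq_flip (L := -innerₗ ℝ)
      Real.continuous_fourierChar continuous_inner.neg hφi hF
    rwa [hsymm] at h
  rw [hinv, flip1] at flip2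
  simpa [hφ] using flip2.symm

lemma sq_lintegral_lintegral_mul_le {f g : ℝ → ℝ → ℝ≥0∞} (hf : Measurable (Function.uncurry f))
    (hg : Measurable (Function.uncurry g)) :
    (∫⁻ x, ∫⁻ y, f x y * g x y) ^ 2 ≤
      (∫⁻ x, ∫⁻ y, f x y ^ 2) * ∫⁻ x, ∫⁻ y, g x y ^ 2 := by
  have h := ENNReal.lintegral_mul_le_Lp_mul_Lq (volume.prod volume)
    Real.HolderConjugate.two_two hf.aemeasurable hg.aemeasurable
  rw [lintegral_prod _ (hf.mul hg).aemeasurable,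
    lintegral_prod _ (hf.pow_const _).aemeasurable,
    lintegral_prod _ (hg.pow_const _).aemeasurable] at h
  simp only [Pi.mul_apply, Function.uncurry_apply_pair, ENNReal.rpow_two] at h
  calc _ ≤ _ := pow_le_pow_left' h 2
    _ = _ := by
      rw [mul_pow, ← ENNReal.rpow_two, ← ENNReal.rpow_two, ← ENNReal.rpow_mul, ← ENNReal.rpow_mul]
      norm_num

lemma modPhi_eq (ξ x y : ℝ) :
    modPhi ξ x y (ξ - x + y) = 2 * ((x - y) * ((ξ - x + y) - y)) := by
  unfold modPhi
  ring

/-- The symbol of `T^w_{|Φ|>M}` weighted for the `H^s` estimate. -/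
noncomputable def weightedSymbol (s M ξ x y : ℝ) : ℝ :=
  if M < |modPhi ξ x y (ξ - x + y)| then
    jb ξ ^ s * (|y| / jb (modPhi ξ x y (ξ - x + y))) *
      (jb x ^ (-s) * jb y ^ (-s) * jb (ξ - x + y) ^ (-s))
  else 0

lemma weightedSymbol_nonneg (s M ξ x y : ℝ) : 0 ≤ weightedSymbol s M ξ x y := by
  have h := jb_pos
  unfold weightedSymbol
  split_ifs
  · have := h ξ; have := h x; have := h y; have := h (ξ - x + y)
    have := h (modPhi ξ x y (ξ - x + y))
    positivity
  · exact le_rfl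

lemma measurable_weightedSymbol (s M ξ : ℝ) :
    Measurable (Function.uncurry (weightedSymbol s M ξ)) := by
  have h := continuous_jb.measurable
  unfold Function.uncurry weightedSymbol modPhi
  refine Measurable.ite (measurableSet_lt (by fun_prop) (by fun_prop)) ?_ measurable_const
  fun_prop

lemma weightedSymbol_sq_le {θ s M : ℝ} (hθ0 : 0 ≤ θ) (hθ1 : θ ≤ 1) (hs : 1 / 2 < s)
    (hM : 1 ≤ M) (ξ x y : ℝ) :
    weightedSymbol s M ξ x y ^ 2 ≤ M⁻¹ * 8 ^ (2 * s) *
      majorant (fun x => jb x ^ (-(2 * s))) (singWeight θ (2 * s - 1)) x y (ξ - x + y) := by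
  have hp := jb_pos
  unfold weightedSymbol
  split_ifs with h
  · set z := ξ - x + y with hz
    have hΦ : |modPhi ξ x y z| = 2 * (|x - y| * |z - y|) := by
      rw [hz, modPhi_eq]
      simp [abs_mul]
    set J := jb (modPhi ξ x y z) with hJ
    have hJM : M ≤ J := h.le.trans (abs_le_jb _)
    have hM0 : 0 < M := by linarith
    have hJ0 : 0 < J := by linarith
    have hprod : 0 < |x - y| * |z - y| := by linarith
    have hx0 : 0 < |x - y| := pos_of_mul_pos_left hprod (abs_nonneg _)
    have hy0 : 0 < |z - y| := pos_of_mul_pos_right hprod (abs_nonneg _)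
    have key := multiplier_sq_le (b := 2 * s - 1) (J := J) hθ0 hθ1 (by linarith) hx0 hy0
      (one_le_jb _) (by rw [← hΦ]; exact abs_le_jb _)
    have e1 : 1 + (2 * s - 1) = 2 * s := by ring
    have e2 : x - y + z = ξ := by rw [hz]; ring
    rw [e1, e2] at key
    have hsq : ∀ t : ℝ, ∀ r : ℝ, (jb t ^ r) ^ 2 = jb t ^ (2 * r) := by
      intro t r
      rw [← Real.rpow_natCast, ← Real.rpow_mul (hp t).le, mul_comm]
      norm_num
    calc (jb ξ ^ s * (|y| / J) * (jb x ^ (-s) * jb y ^ (-s) * jb z ^ (-s))) ^ 2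
        = J⁻¹ * (jb ξ ^ (2 * s) * y ^ 2 * J⁻¹ *
            (jb x ^ (-(2 * s)) * jb y ^ (-(2 * s)) * jb z ^ (-(2 * s)))) := by
          simp only [mul_pow, div_pow, hsq, sq_abs, mul_neg]
          field_simp
      _ ≤ M⁻¹ * (8 ^ (2 * s) * majorant (fun x => jb x ^ (-(2 * s)))
            (singWeight θ (2 * s - 1)) x y z) := by
          have := hp ξ; have := hp x; have := hp y; have := hp z
          gcongr
      _ = _ := by ring
  · have hw := singWeight_nonneg θ (2 * s - 1)
    have h1 : ∀ t, 0 ≤ jb t ^ (-(2 * s)) := fun t => Real.rpow_nonneg (hp t).le _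
    unfold majorant
    have hM0 : 0 < M := by linarith
    rw [zero_pow two_ne_zero]
    have := hw (x - y); have := hw y; have := hw (ξ - x + y - y)
    have := h1 x; have := h1 y; have := h1 (ξ - x + y)
    positivity

/-- The square of the `H^s` norm in terms of the Fourier transform, as an extended real. -/
noncomputable def sobolevMass (s : ℝ) (f : ℝ → ℂ) : ℝ≥0∞ :=
  ∫⁻ x, ENNReal.ofReal (jb x ^ (2 * s)) * ‖f x‖ₑ ^ 2

/-- The Fourier-side trilinear form defining `TwAbove`. -/
noncomputable def trilinearForm (M : ℝ) (f₁ f₂ f₃ : ℝ → ℂ) (ξ : ℝ) : ℂ :=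
  ∫ ξ₁ : ℝ, ∫ ξ₂ : ℝ,
    (if M < |modPhi ξ ξ₁ ξ₂ (ξ - ξ₁ + ξ₂)| then
        ((|ξ₂| / jb (modPhi ξ ξ₁ ξ₂ (ξ - ξ₁ + ξ₂)) : ℝ) : ℂ)
      else 0) *
      f₁ ξ₁ * (starRingEnd ℂ) (f₂ ξ₂) * f₃ (ξ - ξ₁ + ξ₂)

lemma ofReal_mul_enorm_trilinearForm_le (s M : ℝ) (f₁ f₂ f₃ : ℝ → ℂ) (ξ : ℝ) :
    ENNReal.ofReal (jb ξ ^ s) * ‖trilinearForm M f₁ f₂ f₃ ξ‖ₑ ≤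
      ∫⁻ x, ∫⁻ y, ENNReal.ofReal (weightedSymbol s M ξ x y) *
        ((ENNReal.ofReal (jb x ^ s) * ‖f₁ x‖ₑ) * (ENNReal.ofReal (jb y ^ s) * ‖f₂ y‖ₑ) *
          (ENNReal.ofReal (jb (ξ - x + y) ^ s) * ‖f₃ (ξ - x + y)‖ₑ)) := by
  have hp := jb_pos
  have hcancel : ∀ t, ENNReal.ofReal (jb t ^ (-s)) * ENNReal.ofReal (jb t ^ s) = 1 := by
    intro t
    rw [← ENNReal.ofReal_mul (Real.rpow_nonneg (hp t).le _), ← Real.rpow_add (hp t)]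
    simp
  have hnn : ∀ t r : ℝ, 0 ≤ jb t ^ r := fun t r => Real.rpow_nonneg (hp t).le r
  calc _ ≤ ENNReal.ofReal (jb ξ ^ s) * ∫⁻ x, ∫⁻ y, ‖(if M < |modPhi ξ x y (ξ - x + y)| then
        ((|y| / jb (modPhi ξ x y (ξ - x + y)) : ℝ) : ℂ) else 0) *
        f₁ x * (starRingEnd ℂ) (f₂ y) * f₃ (ξ - x + y)‖ₑ := by
        gcongr
        refine (enorm_integral_le_lintegral_enorm _).trans (lintegral_mono fun x => ?_)
        exact enorm_integral_le_lintegral_enorm _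
    _ = _ := by
      rw [← lintegral_const_mul' _ _ ENNReal.ofReal_ne_top]
      refine lintegral_congr fun x => ?_
      rw [← lintegral_const_mul' _ _ ENNReal.ofReal_ne_top]
      refine lintegral_congr fun y => ?_
      unfold weightedSymbol
      split_ifs with h
      · have hq : 0 ≤ |y| / jb (modPhi ξ x y (ξ - x + y)) :=
          div_nonneg (abs_nonneg _) (hp _).le
        have he : ‖((|y| / jb (modPhi ξ x y (ξ - x + y)) : ℝ) : ℂ)‖ₑ =
            ENNReal.ofReal (|y| / jb (modPhi ξ x y (ξ - x + y))) := by
          rw [← ofReal_norm, Complex.norm_real, Real.norm_of_nonneg hq]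
        have hc : ‖(starRingEnd ℂ) (f₂ y)‖ₑ = ‖f₂ y‖ₑ := by
          rw [← ofReal_norm, RCLike.norm_conj, ofReal_norm]
        rw [enorm_mul, enorm_mul, enorm_mul, hc, he,
          ENNReal.ofReal_mul (mul_nonneg (hnn _ _) hq), ENNReal.ofReal_mul (hnn _ _),
          ENNReal.ofReal_mul (mul_nonneg (hnn _ _) (hnn _ _)), ENNReal.ofReal_mul (hnn _ _)]
        calc _ = ENNReal.ofReal (jb ξ ^ s) *
              ENNReal.ofReal (|y| / jb (modPhi ξ x y (ξ - x + y))) * 1 * 1 * 1 *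
              (‖f₁ x‖ₑ * ‖f₂ y‖ₑ * ‖f₃ (ξ - x + y)‖ₑ) := by ring
          _ = ENNReal.ofReal (jb ξ ^ s) *
              ENNReal.ofReal (|y| / jb (modPhi ξ x y (ξ - x + y))) *
              (ENNReal.ofReal (jb x ^ (-s)) * ENNReal.ofReal (jb x ^ s)) *
              (ENNReal.ofReal (jb y ^ (-s)) * ENNReal.ofReal (jb y ^ s)) *
              (ENNReal.ofReal (jb (ξ - x + y) ^ (-s)) * ENNReal.ofReal (jb (ξ - x + y) ^ s)) *
              (‖f₁ x‖ₑ * ‖f₂ y‖ₑ * ‖f₃ (ξ - x + y)‖ₑ) := by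
            rw [hcancel, hcancel, hcancel]
          _ = _ := by ring
      · simp

lemma ofReal_majorant {p q : ℝ → ℝ} (hp : ∀ x, 0 ≤ p x) (hq : ∀ x, 0 ≤ q x) (x y z : ℝ) :
    ENNReal.ofReal (majorant p q x y z) =
      majorant (fun x => ENNReal.ofReal (p x)) (fun x => ENNReal.ofReal (q x)) x y z := by
  have h1 := hp x; have h2 := hp y; have h3 := hp z
  have h4 := hq (x - y); have h5 := hq y; have h6 := hq (z - y)
  unfold majorant
  rw [ENNReal.ofReal_add (by positivity) (by positivity),
    ENNReal.ofReal_add (by positivity) (by positivity),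
    ENNReal.ofReal_add (by positivity) (by positivity),
    ENNReal.ofReal_add (by positivity) (by positivity),
    ENNReal.ofReal_add (by positivity) (by positivity)]
  simp only [ENNReal.ofReal_mul, h1, h2, h4, h6]

lemma lintegral_trilinear_eq {u₁ u₂ u₃ : ℝ → ℝ≥0∞} (h₁ : Measurable u₁) (h₂ : Measurable u₂)
    (h₃ : Measurable u₃) :
    ∫⁻ ξ, ∫⁻ x, ∫⁻ y, u₁ x * u₂ y * u₃ (ξ - x + y) =
      (∫⁻ x, u₁ x) * (∫⁻ x, u₂ x) * ∫⁻ x, u₃ x := by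
  rw [lintegral_lintegral_swap]
  · have : ∀ x, ∫⁻ ξ, ∫⁻ y, u₁ x * u₂ y * u₃ (ξ - x + y) =
        u₁ x * ((∫⁻ y, u₂ y) * ∫⁻ y, u₃ y) := by
      intro x
      rw [lintegral_lintegral_swap (by fun_prop), ← lintegral_lintegral_mul_eq h₂ h₃,
        ← lintegral_const_mul _ (by fun_prop)]
      refine lintegral_congr fun y => ?_
      simp_rw [mul_assoc]
      rw [lintegral_const_mul _ (by fun_prop), lintegral_const_mul _ (by fun_prop),
        lintegral_const_mul _ h₃]
      simp_rw [sub_add]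
      rw [lintegral_sub_right_eq_self u₃]
    simp_rw [this]
    rw [lintegral_mul_const _ h₁, mul_assoc]
  · refine Measurable.aemeasurable ?_
    refine Measurable.lintegral_prod_right' (f := fun p : (ℝ × ℝ) × ℝ =>
      u₁ p.1.2 * u₂ p.2 * u₃ (p.1.1 - p.1.2 + p.2)) ?_
    fun_prop

lemma sobolevMass_trilinearForm_le {θ s M : ℝ} (hθ0 : 0 ≤ θ) (hθ1 : θ ≤ 1) (hs : 1 / 2 < s)
    (hM : 1 ≤ M) {f₁ f₂ f₃ : ℝ → ℂ} (h₁ : Measurable f₁) (h₂ : Measurable f₂)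
    (h₃ : Measurable f₃) :
    sobolevMass s (trilinearForm M f₁ f₂ f₃) ≤
      ENNReal.ofReal (M⁻¹ * 8 ^ (2 * s)) *
        (3 * (∫⁻ x, ENNReal.ofReal (jb x ^ (-(2 * s)))) ^ 2 +
          3 * (∫⁻ x, ENNReal.ofReal (singWeight θ (2 * s - 1) x)) ^ 2) *
        (sobolevMass s f₁ * sobolevMass s f₂ * sobolevMass s f₃) := by
  have hjb := continuous_jb.measurable
  have hw := measurable_singWeight θ (2 * s - 1)
  have hsq : ∀ (t : ℝ) (z : ℂ), (ENNReal.ofReal (jb t ^ s) * ‖z‖ₑ) ^ 2 =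
      ENNReal.ofReal (jb t ^ (2 * s)) * ‖z‖ₑ ^ 2 := by
    intro t z
    rw [mul_pow, ← ENNReal.ofReal_pow (Real.rpow_nonneg (jb_pos t).le _), ← Real.rpow_natCast,
      ← Real.rpow_mul (jb_pos t).le]
    norm_num [mul_comm]
  set w : (ℝ → ℂ) → ℝ → ℝ≥0∞ := fun f x => ENNReal.ofReal (jb x ^ s) * ‖f x‖ₑ with hwdef
  have hwm : ∀ {f : ℝ → ℂ}, Measurable f → Measurable (w f) := by
    intro f hf
    simp only [hwdef]
    fun_prop
  have hw₁ := hwm h₁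
  have hw₂ := hwm h₂
  have hw₃ := hwm h₃
  have hmass : ∀ f, sobolevMass s f = ∫⁻ x, w f x ^ 2 := fun f =>
    lintegral_congr fun x => (hsq x (f x)).symm
  set K : ℝ≥0∞ := ENNReal.ofReal (M⁻¹ * 8 ^ (2 * s)) *
        (3 * (∫⁻ x, ENNReal.ofReal (jb x ^ (-(2 * s)))) ^ 2 +
          3 * (∫⁻ x, ENNReal.ofReal (singWeight θ (2 * s - 1) x)) ^ 2) with hK
  have hsymb : ∀ ξ, ∫⁻ x, ∫⁻ y, ENNReal.ofReal (weightedSymbol s M ξ x y) ^ 2 ≤ K := by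
    intro ξ
    have hpn : ∀ x, 0 ≤ jb x ^ (-(2 * s)) := fun x => Real.rpow_nonneg (jb_pos x).le _
    calc _ ≤ ∫⁻ x, ∫⁻ y, ENNReal.ofReal (M⁻¹ * 8 ^ (2 * s)) *
          majorant (fun x => ENNReal.ofReal (jb x ^ (-(2 * s))))
            (fun x => ENNReal.ofReal (singWeight θ (2 * s - 1) x)) x y (ξ - x + y) := by
          refine lintegral_mono fun x => lintegral_mono fun y => ?_
          rw [← ofReal_majorant hpn (singWeight_nonneg _ _), ← ENNReal.ofReal_mul (by positivity),
            ← ENNReal.ofReal_pow (weightedSymbol_nonneg _ _ _ _ _)]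
          exact ENNReal.ofReal_le_ofReal (weightedSymbol_sq_le hθ0 hθ1 hs hM ξ x y)
      _ = K := by
          simp_rw [lintegral_const_mul' _ _ ENNReal.ofReal_ne_top]
          rw [lintegral_majorant (by fun_prop) (by fun_prop), hK]
          simp only [sq]
  calc sobolevMass s (trilinearForm M f₁ f₂ f₃)
      ≤ ∫⁻ ξ, K * ∫⁻ x, ∫⁻ y, w f₁ x ^ 2 * w f₂ y ^ 2 * w f₃ (ξ - x + y) ^ 2 := by
        refine lintegral_mono fun ξ => ?_
        rw [← hsq]
        refine (pow_le_pow_left' (ofReal_mul_enorm_trilinearForm_le s M f₁ f₂ f₃ ξ) 2).trans ?_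
        refine (sq_lintegral_lintegral_mul_le
          (f := fun x y => ENNReal.ofReal (weightedSymbol s M ξ x y))
          (g := fun x y => w f₁ x * w f₂ y * w f₃ (ξ - x + y))
          (measurable_weightedSymbol s M ξ).ennreal_ofReal (by fun_prop)).trans ?_
        simp only [mul_pow (w f₁ _ * w f₂ _), mul_pow (w f₁ _)]
        gcongr
        exact hsymb ξ
    _ = _ := by
        rw [lintegral_const_mul, lintegral_trilinear_eq (hw₁.pow_const 2) (hw₂.pow_const 2)
          (hw₃.pow_const 2), hmass, hmass, hmass]
        refine Measurable.lintegral_prod_right' (f := fun p : ℝ × ℝ => ∫⁻ y,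
          w f₁ p.2 ^ 2 * w f₂ y ^ 2 * w f₃ (p.1 - p.2 + y) ^ 2) ?_
        refine Measurable.lintegral_prod_right' (f := fun p : (ℝ × ℝ) × ℝ =>
          w f₁ p.1.2 ^ 2 * w f₂ p.2 ^ 2 * w f₃ (p.1.1 - p.1.2 + p.2) ^ 2) ?_
        fun_prop

lemma ofReal_rpow_mul_norm_sq (s x : ℝ) (z : ℂ) :
    ENNReal.ofReal (jb x ^ (2 * s) * ‖z‖ ^ 2) = ENNReal.ofReal (jb x ^ (2 * s)) * ‖z‖ₑ ^ 2 := by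
  rw [ENNReal.ofReal_mul (Real.rpow_nonneg (jb_pos x).le _), ENNReal.ofReal_pow (norm_nonneg z),
    ofReal_norm]

lemma integral_nonneg_weight (s : ℝ) (f : ℝ → ℂ) : 0 ≤ ∫ x, jb x ^ (2 * s) * ‖f x‖ ^ 2 :=
  integral_nonneg fun x => mul_nonneg (Real.rpow_nonneg (jb_pos x).le _) (sq_nonneg _)

lemma ofReal_integral_le_sobolevMass (s : ℝ) (f : ℝ → ℂ) :
    ENNReal.ofReal (∫ x, jb x ^ (2 * s) * ‖f x‖ ^ 2) ≤ sobolevMass s f := by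
  have hn : ∀ x, 0 ≤ jb x ^ (2 * s) * ‖f x‖ ^ 2 := fun x =>
    mul_nonneg (Real.rpow_nonneg (jb_pos x).le _) (sq_nonneg _)
  rw [← Real.enorm_of_nonneg (integral_nonneg_weight s f)]
  refine (enorm_integral_le_lintegral_enorm _).trans_eq (lintegral_congr fun x => ?_)
  rw [Real.enorm_of_nonneg (hn x), ofReal_rpow_mul_norm_sq]

lemma sobolevMass_fourier_of_memHs {s : ℝ} {v : ℝ → ℂ} (hv : memHs s v) :
    sobolevMass s (𝓕 v) = ENNReal.ofReal (∫ x, jb x ^ (2 * s) * ‖𝓕 v x‖ ^ 2) := by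
  rw [ofReal_integral_eq_lintegral_ofReal hv (.of_forall fun x =>
    mul_nonneg (Real.rpow_nonneg (jb_pos x).le _) (sq_nonneg _))]
  exact lintegral_congr fun x => (ofReal_rpow_mul_norm_sq s x _).symm

/-- No integrability of `F` or `𝓕⁻ F` is needed: otherwise the left-hand side vanishes. -/
lemma ofReal_integral_fourier_fourierInv_le (s : ℝ) (F : ℝ → ℂ) :
    ENNReal.ofReal (∫ x, jb x ^ (2 * s) * ‖𝓕 (𝓕⁻ F) x‖ ^ 2) ≤ sobolevMass s F := by
  by_cases hFinv : Integrable (𝓕⁻ F)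
  · by_cases hF : Integrable F
    · refine le_trans (le_of_eq ?_) (ofReal_integral_le_sobolevMass s F)
      congr 1
      refine integral_congr_ae ?_
      filter_upwards [fourier_fourierInv_ae_eq hF hFinv] with x hx
      rw [hx]
    · have h0 : 𝓕⁻ F = 0 := by
        funext w
        rw [Real.fourierInv_eq_fourier_neg, fourier_eq_zero_of_not_integrable hF]
        rfl
      have h1 : 𝓕 (0 : ℝ → ℂ) = 0 := by
        funext w
        simp [Real.fourier_eq]
      simp [h0, h1]
  · simp [fourier_eq_zero_of_not_integrable hFinv]

/-- The strong-norm estimate for `T^w_{|Φ|>M}`: for `s > 1/2` and `M ≥ 1`,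
`‖T^w_{|Φ|>M}(v₁,v₂,v₃)‖_{H^s} ≤ C M^{-1/2} ∏ ‖v_j‖_{H^s}`. -/
theorem Tw_strong_estimate (s : ℝ) (hs : 1 / 2 < s) :
    ∃ C : ℝ, 0 < C ∧ ∀ M : ℝ, 1 ≤ M → ∀ v₁ v₂ v₃ : ℝ → ℂ,
      memHs s v₁ → memHs s v₂ → memHs s v₃ →
      sobolevNorm s (TwAbove M v₁ v₂ v₃) ≤
        C * M ^ (-(1 / 2) : ℝ) *
          (sobolevNorm s v₁ * sobolevNorm s v₂ * sobolevNorm s v₃) := by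
  set θ : ℝ := max (1 - (2 * s - 1) / 2) (1 / 2) with hθ
  have hθ0 : 0 ≤ θ := le_max_of_le_right (by norm_num)
  have hθ1 : θ < 1 := max_lt (by linarith) (by norm_num)
  have hθb : 1 < θ + (2 * s - 1) := by
    have := le_max_left (1 - (2 * s - 1) / 2) (1 / 2)
    linarith
  set K : ℝ≥0∞ := 3 * (∫⁻ x, ENNReal.ofReal (jb x ^ (-(2 * s)))) ^ 2 +
    3 * (∫⁻ x, ENNReal.ofReal (singWeight θ (2 * s - 1) x)) ^ 2 with hK
  have hKtop : K ≠ ⊤ := by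
    have h1 := (integrable_jb_rpow_neg (a := 2 * s) (by linarith)).lintegral_lt_top.ne
    have h2 := (integrable_singWeight hθ1 (by linarith) hθb).lintegral_lt_top.ne
    finiteness
  have hD : 0 ≤ 8 ^ (2 * s) * K.toReal := by positivity
  refine ⟨√(8 ^ (2 * s) * K.toReal) + 1, by positivity, fun M hM v₁ v₂ v₃ h₁ h₂ h₃ => ?_⟩
  have hM0 : 0 < M := by linarith
  have main := (ofReal_integral_fourier_fourierInv_le s
    (trilinearForm M (𝓕 v₁) (𝓕 v₂) (𝓕 v₃))).trans
    (sobolevMass_trilinearForm_le hθ0 hθ1.le hs hM (measurable_fourier v₁) (measurable_fourier v₂)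
      (measurable_fourier v₃))
  rw [sobolevMass_fourier_of_memHs h₁, sobolevMass_fourier_of_memHs h₂,
    sobolevMass_fourier_of_memHs h₃, ← hK, ← ENNReal.ofReal_toReal hKtop] at main
  have n₁ := integral_nonneg_weight s (𝓕 v₁)
  have n₂ := integral_nonneg_weight s (𝓕 v₂)
  have n₃ := integral_nonneg_weight s (𝓕 v₃)
  change sobolevNorm s (𝓕⁻ (trilinearForm M (𝓕 v₁) (𝓕 v₂) (𝓕 v₃))) ≤ _
  unfold sobolevNorm
  set N₁ := ∫ x, jb x ^ (2 * s) * ‖𝓕 v₁ x‖ ^ 2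
  set N₂ := ∫ x, jb x ^ (2 * s) * ‖𝓕 v₂ x‖ ^ 2
  set N₃ := ∫ x, jb x ^ (2 * s) * ‖𝓕 v₃ x‖ ^ 2
  rw [← ENNReal.ofReal_mul n₁, ← ENNReal.ofReal_mul (by positivity),
    ← ENNReal.ofReal_mul (by positivity), ← ENNReal.ofReal_mul (by positivity),
    ENNReal.ofReal_le_ofReal_iff (by positivity)] at main
  have hMr : M ^ (-(1 / 2) : ℝ) = √M⁻¹ := by
    rw [Real.rpow_neg hM0.le, Real.sqrt_inv, Real.sqrt_eq_rpow]
  simp only [hMr, ← Real.sqrt_eq_rpow]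
  calc _ ≤ √(M⁻¹ * 8 ^ (2 * s) * K.toReal * (N₁ * N₂ * N₃)) := Real.sqrt_le_sqrt main
    _ = √(8 ^ (2 * s) * K.toReal) * √M⁻¹ * (√N₁ * √N₂ * √N₃) := by
      rw [← Real.sqrt_mul n₁, ← Real.sqrt_mul hD, ← Real.sqrt_mul (by positivity),
        ← Real.sqrt_mul (by positivity)]
      congr 1
      ring
    _ ≤ _ := by
      gcongr
      linarith
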